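/- arXiv:2508.13342 — 5 statements merged into one kernel-verified Lean document; each statement's English description precedes it below -/
import Mathlib

section
/- (Conditional L²-error estimate.) Assume |𝒜[X, Y]| ≤ C_𝒜 ‖X‖ ‖Y‖ for all X, Y ∈ V with C_𝒜 ≥ 0. Suppose W ∈ V and W_h ∈ V_h satisfy the quasi-orthogonality relation 𝒜[W − Π W_h, Π Y_h] = k(W_h, Y_h) for all Y_h ∈ V_h. Set E := W − Π W_h, and suppose there exist Z ∈ V, Z_h ∈ V_h, and δ ≥ 0 such that 𝒜[Y, Z] = ⟨E, Y⟩₀ for all Y ∈ V and E_h[Z, Z_h] ≤ δ |E|₀. Then |E|₀ ≤ max{1, C_𝒜} · δ · E_h[W, W_h]. -/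
/-- Cauchy–Schwarz in `ℝ²`, with the second coordinates given by their squares. -/
theorem mul_add_le_sqrt_mul_sqrt {a b c p q : ℝ} (hp : 0 ≤ p) (hq : 0 ≤ q)
    (hc : c ^ 2 ≤ p * q) :
    a * b + c ≤ √(a ^ 2 + p) * √(b ^ 2 + q) := by
  rw [← Real.sqrt_mul (by positivity)]
  refine Real.le_sqrt_of_sq_le ?_
  have hcross : 2 * (a * b * c) ≤ a ^ 2 * q + b ^ 2 * p := by
    refine abs_le_of_sq_le_sq' ?_ (by positivity) |>.2
    nlinarith [sq_nonneg (a ^ 2 * q - b ^ 2 * p),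
      mul_le_mul_of_nonneg_left hc (sq_nonneg (a * b))]
  linarith

/-- **Conditional L²-error estimate** (abstract form of the paper's Lemma
"conditional L²-error estimate", via the Aubin–Nitsche duality argument). With
`|Y|₀ = √(ip0 Y Y)`, `E_h[V, V_h] = (‖V − Π V_h‖² + k(V_h, V_h))^{1/2}`, continuity
`|𝒜[X,Y]| ≤ C_𝒜 ‖X‖‖Y‖`, quasi-orthogonality for `W, W_h`, an adjoint solution `Z`
with data `E := W − Π W_h`, and an approximation `Z_h` with `E_h[Z, Z_h] ≤ δ |E|₀`,
one gets `|E|₀ ≤ max{1, C_𝒜} · δ · E_h[W, W_h]`. -/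
theorem conditional_L2_error_estimate {V Vh : Type*}
    [NormedAddCommGroup V] [NormedSpace ℝ V]
    [AddCommGroup Vh] [Module ℝ Vh]
    (A : V →ₗ[ℝ] V →ₗ[ℝ] ℝ)
    (ip0 : V →ₗ[ℝ] V →ₗ[ℝ] ℝ)
    (hip0_symm : ∀ x y : V, ip0 x y = ip0 y x) (hip0_pos : ∀ x : V, 0 ≤ ip0 x x)
    (Proj : Vh →ₗ[ℝ] V)
    (k : Vh →ₗ[ℝ] Vh →ₗ[ℝ] ℝ)
    (hk_symm : ∀ x y : Vh, k x y = k y x) (hk_pos : ∀ x : Vh, 0 ≤ k x x)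
    (sem0 : V → ℝ) (hsem0 : ∀ v : V, sem0 v = Real.sqrt (ip0 v v))
    (Eh : V → Vh → ℝ)
    (hEh : ∀ (v : V) (vh : Vh), Eh v vh = Real.sqrt (‖v - Proj vh‖ ^ 2 + k vh vh))
    (CA : ℝ) (hCA : 0 ≤ CA)
    (hcont : ∀ x y : V, |A x y| ≤ CA * ‖x‖ * ‖y‖)
    (W : V) (Wh : Vh)
    (hQO : ∀ Yh : Vh, A (W - Proj Wh) (Proj Yh) = k Wh Yh)
    (Z : V) (Zh : Vh) (δ : ℝ) (hδ : 0 ≤ δ)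
    (hZ : ∀ Y : V, A Y Z = ip0 (W - Proj Wh) Y)
    (hZh : Eh Z Zh ≤ δ * sem0 (W - Proj Wh)) :
    sem0 (W - Proj Wh) ≤ max 1 CA * δ * Eh W Wh := by
  set E := W - Proj Wh
  set M := max 1 CA
  have hM : 1 ≤ M := le_max_left _ _
  have hk : k Wh Zh ^ 2 ≤ k Wh Wh * k Zh Zh :=
    LinearMap.BilinForm.apply_sq_le_of_symm k hk_pos ⟨hk_symm⟩ Wh Zh
  have hA : A E (Z - Proj Zh) ≤ M * (‖E‖ * ‖Z - Proj Zh‖) :=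
    calc A E (Z - Proj Zh) ≤ CA * ‖E‖ * ‖Z - Proj Zh‖ := (le_abs_self _).trans (hcont _ _)
      _ = CA * (‖E‖ * ‖Z - Proj Zh‖) := by ring
      _ ≤ M * (‖E‖ * ‖Z - Proj Zh‖) := by gcongr; exact le_max_right _ _
  have hkM : k Wh Zh ≤ M * |k Wh Zh| :=
    (le_abs_self _).trans (le_mul_of_one_le_left (abs_nonneg _) hM)
  have hsplit : ip0 E E = A E (Z - Proj Zh) + k Wh Zh := by
    rw [← hZ, ← hQO, ← map_add, sub_add_cancel]
  have hE0 : 0 ≤ Eh W Wh := by rw [hEh]; positivity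
  have hs0 : 0 ≤ sem0 E := by rw [hsem0]; positivity
  have hsq : sem0 E * sem0 E ≤ M * δ * Eh W Wh * sem0 E :=
    calc sem0 E * sem0 E = ip0 E E := by rw [hsem0, Real.mul_self_sqrt (hip0_pos _)]
      _ ≤ M * (‖E‖ * ‖Z - Proj Zh‖ + |k Wh Zh|) := by rw [hsplit]; linarith
      _ ≤ M * (Eh W Wh * Eh Z Zh) := by
        rw [hEh, hEh]
        gcongr
        exact mul_add_le_sqrt_mul_sqrt (hk_pos _) (hk_pos _) (by rwa [sq_abs])
      _ ≤ M * (Eh W Wh * (δ * sem0 E)) := by gcongr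
      _ = M * δ * Eh W Wh * sem0 E := by ring
  rcases hs0.eq_or_lt with h | h
  · rw [← h]
    positivity
  · exact le_of_mul_le_mul_right hsq h
end

section
/- (Conditional quasi-optimality.) Assume |𝒜[X, Y]| ≤ C_𝒜 ‖X‖ ‖Y‖ for all X, Y ∈ V with C_𝒜 ≥ 0, and the Gårding inequality c₁ ‖Y‖² − c₂ |Y|₀² ≤ 𝒜[Y, Y] for all Y ∈ V, where 0 < c₁ ≤ 1 and c₂ > 0. Suppose W ∈ V and W_h ∈ V_h satisfy the quasi-orthogonality relation 𝒜[W − Π W_h, Π Y_h] = k(W_h, Y_h) for all Y_h ∈ V_h, and the L²-error estimate |W − Π W_h|₀ ≤ C₈ h E_h[W, W_h] for some C₈ > 0 and h > 0. If h ≤ h₀ := (c₁ / (4 c₂ C₈²))^{1/2}, then E_h[W, W_h] ≤ C₉ E_h[W, V_h] for every V_h ∈ V_h, where C₉ := √2 · max{1, C_𝒜} / c₁. -/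
/-- **Conditional quasi-optimality** (abstract form of the paper's Lemma "conditional
quasi-optimality in V₁,₁", following Schatz's argument). Under continuity, a Gårding
inequality, quasi-orthogonality and the conditional L²-error estimate
`|W − Π W_h|₀ ≤ C₈ h E_h[W, W_h]`, if `h ≤ h₀ := (c₁/(4 c₂ C₈²))^{1/2}` then the
Galerkin solution is quasi-optimal: `E_h[W, W_h] ≤ C₉ E_h[W, V_h]` for all `V_h`,
with `C₉ = √2 · max{1, C_𝒜} / c₁`. -/
theorem conditional_quasi_optimality {V Vh : Type*}
    [NormedAddCommGroup V] [NormedSpace ℝ V]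
    [AddCommGroup Vh] [Module ℝ Vh]
    (A : V →ₗ[ℝ] V →ₗ[ℝ] ℝ)
    (ip0 : V →ₗ[ℝ] V →ₗ[ℝ] ℝ)
    (hip0_symm : ∀ x y : V, ip0 x y = ip0 y x) (hip0_pos : ∀ x : V, 0 ≤ ip0 x x)
    (Proj : Vh →ₗ[ℝ] V)
    (k : Vh →ₗ[ℝ] Vh →ₗ[ℝ] ℝ)
    (hk_symm : ∀ x y : Vh, k x y = k y x) (hk_pos : ∀ x : Vh, 0 ≤ k x x)
    (sem0 : V → ℝ) (hsem0 : ∀ v : V, sem0 v = Real.sqrt (ip0 v v))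
    (Eh : V → Vh → ℝ)
    (hEh : ∀ (v : V) (vh : Vh), Eh v vh = Real.sqrt (‖v - Proj vh‖ ^ 2 + k vh vh))
    (CA : ℝ) (hCA : 0 ≤ CA)
    (hcont : ∀ x y : V, |A x y| ≤ CA * ‖x‖ * ‖y‖)
    (c₁ c₂ : ℝ) (hc₁0 : 0 < c₁) (hc₁1 : c₁ ≤ 1) (hc₂ : 0 < c₂)
    (hGarding : ∀ Y : V, c₁ * ‖Y‖ ^ 2 - c₂ * (sem0 Y) ^ 2 ≤ A Y Y)
    (W : V) (Wh : Vh)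
    (hQO : ∀ Yh : Vh, A (W - Proj Wh) (Proj Yh) = k Wh Yh)
    (C₈ : ℝ) (hC₈ : 0 < C₈) (h : ℝ) (hh : 0 < h)
    (hL2 : sem0 (W - Proj Wh) ≤ C₈ * h * Eh W Wh)
    (hsmall : h ≤ Real.sqrt (c₁ / (4 * c₂ * C₈ ^ 2))) :
    ∀ Vh' : Vh, Eh W Wh ≤ (Real.sqrt 2 * max 1 CA / c₁) * Eh W Vh' := by
  intro Vh'
  have hE0 : 0 ≤ Eh W Wh := hEh W Wh ▸ Real.sqrt_nonneg _
  have hF0 : 0 ≤ Eh W Vh' := hEh W Vh' ▸ Real.sqrt_nonneg _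
  have hs0 : 0 ≤ sem0 (W - Proj Wh) := hsem0 _ ▸ Real.sqrt_nonneg _
  have hE2 : Eh W Wh ^ 2 = ‖W - Proj Wh‖ ^ 2 + k Wh Wh := by
    rw [hEh, Real.sq_sqrt (add_nonneg (sq_nonneg _) (hk_pos _))]
  have hF2 : Eh W Vh' ^ 2 = ‖W - Proj Vh'‖ ^ 2 + k Vh' Vh' := by
    rw [hEh, Real.sq_sqrt (add_nonneg (sq_nonneg _) (hk_pos _))]
  have hG := hGarding (W - Proj Wh)
  have hsplit : A (W - Proj Wh) (W - Proj Wh) + k Wh Wh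
      = A (W - Proj Wh) (W - Proj Vh') + k Wh Vh' := by
    rw [← hQO Wh, ← hQO Vh', ← map_add, ← map_add, sub_add_cancel, sub_add_cancel]
  have hA := (le_abs_self _).trans (hcont (W - Proj Wh) (W - Proj Vh'))
  have hkCS : k Wh Vh' ≤ √(k Wh Wh) * √(k Vh' Vh') := by
    rw [← Real.sqrt_mul (hk_pos Wh)]
    apply Real.le_sqrt_of_sq_le
    exact LinearMap.BilinForm.apply_sq_le_of_symm k hk_pos ⟨hk_symm⟩ Wh Vh'
  have ha := Real.sq_sqrt (hk_pos Wh)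
  have hb := Real.sq_sqrt (hk_pos Vh')
  have hsum : ‖W - Proj Wh‖ * ‖W - Proj Vh'‖ + √(k Wh Wh) * √(k Vh' Vh')
      ≤ Eh W Wh * Eh W Vh' := by
    apply le_of_sq_le_sq _ (mul_nonneg hE0 hF0)
    rw [mul_pow, hE2, hF2, ← ha, ← hb]
    simp only [Real.sqrt_sq (Real.sqrt_nonneg _)]
    nlinarith [sq_nonneg (‖W - Proj Wh‖ * √(k Vh' Vh') - √(k Wh Wh) * ‖W - Proj Vh'‖)]
  have hM1 : 1 ≤ max 1 CA := le_max_left _ _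
  have hMC : CA ≤ max 1 CA := le_max_right _ _
  generalize max 1 CA = M at *
  have hM0 : 0 ≤ M := zero_le_one.trans hM1
  have hh2 : c₂ * (C₈ * h) ^ 2 ≤ c₁ / 4 := by
    have h2 : h ^ 2 ≤ c₁ / (4 * c₂ * C₈ ^ 2) :=
      (Real.le_sqrt hh.le (by positivity)).1 hsmall
    rw [le_div_iff₀ (by positivity)] at h2
    linarith
  have hs2 : c₂ * sem0 (W - Proj Wh) ^ 2 ≤ c₁ / 4 * Eh W Wh ^ 2 :=
    calc c₂ * sem0 (W - Proj Wh) ^ 2 ≤ c₂ * (C₈ * h * Eh W Wh) ^ 2 := by gcongr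
      _ = c₂ * (C₈ * h) ^ 2 * Eh W Wh ^ 2 := by ring
      _ ≤ c₁ / 4 * Eh W Wh ^ 2 := by gcongr
  have hupper : A (W - Proj Wh) (W - Proj Vh') + k Wh Vh' ≤ M * (Eh W Wh * Eh W Vh') := by
    have h1 : CA * ‖W - Proj Wh‖ * ‖W - Proj Vh'‖ ≤ M * ‖W - Proj Wh‖ * ‖W - Proj Vh'‖ := by
      gcongr
    have h2 : √(k Wh Wh) * √(k Vh' Vh') ≤ M * (√(k Wh Wh) * √(k Vh' Vh')) :=
      le_mul_of_one_le_left (by positivity) hM1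
    have h3 := mul_le_mul_of_nonneg_left hsum hM0
    linarith
  have hkW : c₁ * k Wh Wh ≤ k Wh Wh := mul_le_of_le_one_left (hk_pos Wh) hc₁1
  have hcore : (3 / 4 * c₁ * Eh W Wh) * Eh W Wh ≤ (M * Eh W Vh') * Eh W Wh := by
    have hc : c₁ * Eh W Wh ^ 2 = c₁ * ‖W - Proj Wh‖ ^ 2 + c₁ * k Wh Wh := by
      rw [hE2, mul_add]
    linarith
  have hroot : 4 / 3 ≤ √2 := Real.le_sqrt_of_sq_le (by norm_num)
  have hMF : 0 ≤ M * Eh W Vh' := mul_nonneg hM0 hF0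
  rcases hE0.eq_or_lt with hE | hE
  · rw [← hE]
    positivity
  · have hlin := le_of_mul_le_mul_right hcore hE
    rw [div_mul_eq_mul_div, le_div_iff₀ hc₁0]
    nlinarith [mul_le_mul_of_nonneg_right hroot hMF]
end

section
/- (Discrete well-posedness.) Assume V_h is finite-dimensional and ‖·‖_h is a norm on V_h (i.e., ‖V_h‖_h = 0 implies V_h = 0). Let C₉ ≥ 0, and assume the conditional quasi-optimality property: for every linear map G : V → ℝ, every W ∈ V with 𝒜[W, Π Y_h] = G(Π Y_h) for all Y_h ∈ V_h, and every W_h ∈ V_h with 𝒜_h[W_h, Y_h] = G(Π Y_h) for all Y_h ∈ V_h, one has E_h[W, W_h] ≤ C₉ E_h[W, V_h] for all V_h ∈ V_h. Then: (i) for every linear functional ℓ : V_h → ℝ there exists a unique W_h ∈ V_h with 𝒜_h[W_h, Y_h] = ℓ(Y_h) for all Y_h ∈ V_h; and (ii) if moreover G : V → ℝ is linear, W ∈ V satisfies 𝒜[W, Π Y_h] = G(Π Y_h) for all Y_h ∈ V_h with ‖W‖ ≤ C₃ g for some C₃, g ≥ 0, and W_h solves 𝒜_h[W_h, Y_h] =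 G(Π Y_h) for all Y_h ∈ V_h, then ‖W_h‖_h ≤ C₃ (1 + C₉) g. -/
/-- Minkowski-type bound for a norm augmented by a nonnegative stabilization term `q`. -/
lemma sqrt_norm_sq_add_le {V : Type*} [SeminormedAddCommGroup V] (v w : V) {q : ℝ} (hq : 0 ≤ q) :
    √(‖w‖ ^ 2 + q) ≤ ‖v‖ + √(‖v - w‖ ^ 2 + q) := by
  have hle : ‖v - w‖ ≤ √(‖v - w‖ ^ 2 + q) := Real.le_sqrt_of_sq_le (by linarith)
  have hsq : √(‖v - w‖ ^ 2 + q) ^ 2 = ‖v - w‖ ^ 2 + q := Real.sq_sqrt (by positivity)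
  have htri : ‖w‖ ≤ ‖v‖ + ‖v - w‖ := norm_le_norm_add_norm_sub v w
  have hpow : ‖w‖ ^ 2 ≤ (‖v‖ + ‖v - w‖) ^ 2 := by gcongr
  have hmul : ‖v‖ * ‖v - w‖ ≤ ‖v‖ * √(‖v - w‖ ^ 2 + q) := by gcongr
  refine Real.sqrt_le_iff.2 ⟨by positivity, ?_⟩
  linarith [add_sq ‖v‖ ‖v - w‖, add_sq ‖v‖ √(‖v - w‖ ^ 2 + q)]

/-- On a finite-dimensional space, a bilinear form with trivial left kernel represents every
linear functional uniquely. -/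
lemma LinearMap.existsUnique_forall_apply_eq {K E : Type*} [Field K] [AddCommGroup E] [Module K E]
    [FiniteDimensional K E] (B : E →ₗ[K] E →ₗ[K] K)
    (hB : ∀ w, (∀ y, B w y = 0) → w = 0) (ℓ : E →ₗ[K] K) :
    ∃! w, ∀ y, B w y = ℓ y := by
  have hinj : Function.Injective B :=
    (injective_iff_map_eq_zero B).2 fun w hw => hB w fun y => by simp [hw]
  have hsurj : Function.Surjective B :=
    (LinearMap.injective_iff_surjective_of_finrank_eq_finrank
      (Subspace.dual_finrank_eq (K := K) (V := E)).symm).1 hinj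
  obtain ⟨w, hw⟩ := hsurj ℓ
  refine ⟨w, fun y => by rw [hw], fun w' hw' => hinj ?_⟩
  rw [hw]
  exact LinearMap.ext hw'

/-- **Discrete well-posedness** (abstract form of the paper's Theorem "properties of
discrete elliptic problem"). If `V_h` is finite-dimensional, `‖·‖_h` is a norm, and the
conditional quasi-optimality property holds, then (i) the discrete problem is uniquely
solvable for arbitrary data, and (ii) the discrete solution obeys the stability bound
`‖W_h‖_h ≤ C₃ (1 + C₉) g` whenever the continuous solution satisfies `‖W‖ ≤ C₃ g`. -/
theorem discrete_wellposedness {V Vh : Type*}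
    [NormedAddCommGroup V] [NormedSpace ℝ V]
    [AddCommGroup Vh] [Module ℝ Vh] [FiniteDimensional ℝ Vh]
    (A : V →ₗ[ℝ] V →ₗ[ℝ] ℝ)
    (ip0 : V →ₗ[ℝ] V →ₗ[ℝ] ℝ)
    (hip0_symm : ∀ x y : V, ip0 x y = ip0 y x) (hip0_pos : ∀ x : V, 0 ≤ ip0 x x)
    (Proj : Vh →ₗ[ℝ] V)
    (k : Vh →ₗ[ℝ] Vh →ₗ[ℝ] ℝ)
    (hk_symm : ∀ x y : Vh, k x y = k y x) (hk_pos : ∀ x : Vh, 0 ≤ k x x)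
    (Ah : Vh → Vh → ℝ)
    (hAh : ∀ Wh Yh : Vh, Ah Wh Yh = A (Proj Wh) (Proj Yh) + k Wh Yh)
    (Eh : V → Vh → ℝ)
    (hEh : ∀ (v : V) (vh : Vh), Eh v vh = Real.sqrt (‖v - Proj vh‖ ^ 2 + k vh vh))
    (normh : Vh → ℝ)
    (hnormh : ∀ vh : Vh, normh vh = Real.sqrt (‖Proj vh‖ ^ 2 + k vh vh))
    (hnorm : ∀ vh : Vh, normh vh = 0 → vh = 0)
    (C₉ : ℝ) (hC₉ : 0 ≤ C₉)
    (hQopt : ∀ (G : V →ₗ[ℝ] ℝ) (W : V), (∀ Yh : Vh, A W (Proj Yh) = G (Proj Yh)) →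
      ∀ Wh : Vh, (∀ Yh : Vh, Ah Wh Yh = G (Proj Yh)) →
      ∀ Vh' : Vh, Eh W Wh ≤ C₉ * Eh W Vh') :
    (∀ ℓ : Vh →ₗ[ℝ] ℝ, ∃! Wh : Vh, ∀ Yh : Vh, Ah Wh Yh = ℓ Yh) ∧
    (∀ (G : V →ₗ[ℝ] ℝ) (W : V) (C₃ g : ℝ), 0 ≤ C₃ → 0 ≤ g →
      (∀ Yh : Vh, A W (Proj Yh) = G (Proj Yh)) → ‖W‖ ≤ C₃ * g →
      ∀ Wh : Vh, (∀ Yh : Vh, Ah Wh Yh = G (Proj Yh)) →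
        normh Wh ≤ C₃ * (1 + C₉) * g) := by
  have hstab : ∀ (G : V →ₗ[ℝ] ℝ) (W : V), (∀ Yh : Vh, A W (Proj Yh) = G (Proj Yh)) →
      ∀ Wh : Vh, (∀ Yh : Vh, Ah Wh Yh = G (Proj Yh)) → normh Wh ≤ (1 + C₉) * ‖W‖ := by
    intro G W hW Wh hWh
    have hE := hQopt G W hW Wh hWh 0
    have hE0 : Eh W 0 = ‖W‖ := by simp [hEh]
    have htri := sqrt_norm_sq_add_le W (Proj Wh) (hk_pos Wh)
    rw [← hnormh, ← hEh] at htri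
    rw [hE0] at hE
    linarith
  refine ⟨fun ℓ => ?_, fun G W C₃ g _ _ hW hWg Wh hWh => ?_⟩
  · have hB : ∀ Wh Yh, (A.compl₁₂ Proj Proj + k) Wh Yh = Ah Wh Yh := fun Wh Yh => by simp [hAh]
    simp only [← hB]
    refine LinearMap.existsUnique_forall_apply_eq _ (fun Wh hWh => hnorm Wh ?_) ℓ
    have hle := hstab 0 0 (by simp) Wh fun Yh => by simpa [hAh] using hWh Yh
    rw [norm_zero, mul_zero] at hle
    exact hle.antisymm (hnormh Wh ▸ Real.sqrt_nonneg _)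
  · calc
      normh Wh ≤ (1 + C₉) * ‖W‖ := hstab G W hW Wh hWh
      _ ≤ (1 + C₉) * (C₃ * g) := by gcongr
      _ = C₃ * (1 + C₉) * g := by ring
end

section
/- (Properties of the discrete bilinear form.) Assume |𝒜[X, Y]| ≤ C_𝒜 ‖X‖ ‖Y‖ for all X, Y ∈ V with C_𝒜 ≥ 1, and the Gårding inequality c₁ ‖Y‖² − c₂ |Y|₀² ≤ 𝒜[Y, Y] for all Y ∈ V, where 0 < c₁ ≤ 1 and c₂ ≥ 0. Then the discrete bilinear form satisfies, for all W_h, V_h ∈ V_h: the Gårding inequality c₁ ‖W_h‖_h² − c₂ |Π W_h|₀² ≤ 𝒜_h[W_h, W_h], and the continuity estimate |𝒜_h[W_h, V_h]| ≤ C_𝒜 ‖W_h‖_h ‖V_h‖_h. -/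
/-- Cauchy–Schwarz in the plane, with the second coordinates given by their squares. -/
lemma mul_add_abs_le_sqrt_mul_sqrt {a b p q r : ℝ} (hp : 0 ≤ p) (hq : 0 ≤ q)
    (hr : r ^ 2 ≤ p * q) :
    a * b + |r| ≤ √(a ^ 2 + p) * √(b ^ 2 + q) := by
  have hr' : |r| ≤ √p * √q := by
    rw [← Real.sqrt_mul hp]
    exact Real.abs_le_sqrt hr
  rw [← Real.sqrt_mul (by positivity)]
  refine (add_le_add_right hr' _).trans (Real.le_sqrt_of_sq_le ?_)
  nlinarith [sq_nonneg (a * √q - b * √p), Real.sq_sqrt hp, Real.sq_sqrt hq,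
    congrArg₂ (· * ·) (Real.sq_sqrt hp) (Real.sq_sqrt hq)]

/-- **Properties of the discrete bilinear form** (abstract form of the paper's Lemma
"properties of 𝒜_h"). Continuity and the Gårding inequality transfer from the
continuous bilinear form `𝒜` to the penalized discrete form
`𝒜_h[W_h, V_h] = 𝒜[Π W_h, Π V_h] + k(W_h, V_h)` with the same constants, in the
mesh-dependent norm `‖V_h‖_h = (‖Π V_h‖² + k(V_h, V_h))^{1/2}`. -/
theorem properties_of_discrete_form {V Vh : Type*}
    [NormedAddCommGroup V] [NormedSpace ℝ V]
    [AddCommGroup Vh] [Module ℝ Vh]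
    (A : V →ₗ[ℝ] V →ₗ[ℝ] ℝ)
    (ip0 : V →ₗ[ℝ] V →ₗ[ℝ] ℝ)
    (hip0_symm : ∀ x y : V, ip0 x y = ip0 y x) (hip0_pos : ∀ x : V, 0 ≤ ip0 x x)
    (Proj : Vh →ₗ[ℝ] V)
    (k : Vh →ₗ[ℝ] Vh →ₗ[ℝ] ℝ)
    (hk_symm : ∀ x y : Vh, k x y = k y x) (hk_pos : ∀ x : Vh, 0 ≤ k x x)
    (Ah : Vh → Vh → ℝ)
    (hAh : ∀ Wh Yh : Vh, Ah Wh Yh = A (Proj Wh) (Proj Yh) + k Wh Yh)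
    (sem0 : V → ℝ) (hsem0 : ∀ v : V, sem0 v = Real.sqrt (ip0 v v))
    (normh : Vh → ℝ)
    (hnormh : ∀ vh : Vh, normh vh = Real.sqrt (‖Proj vh‖ ^ 2 + k vh vh))
    (CA : ℝ) (hCA : 1 ≤ CA)
    (hcont : ∀ x y : V, |A x y| ≤ CA * ‖x‖ * ‖y‖)
    (c₁ c₂ : ℝ) (hc₁0 : 0 < c₁) (hc₁1 : c₁ ≤ 1) (hc₂ : 0 ≤ c₂)
    (hGarding : ∀ Y : V, c₁ * ‖Y‖ ^ 2 - c₂ * (sem0 Y) ^ 2 ≤ A Y Y) :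
    ∀ Wh Vh' : Vh,
      (c₁ * (normh Wh) ^ 2 - c₂ * (sem0 (Proj Wh)) ^ 2 ≤ Ah Wh Wh) ∧
      |Ah Wh Vh'| ≤ CA * normh Wh * normh Vh' := by
  intro Wh Yh
  have hsq : normh Wh ^ 2 = ‖Proj Wh‖ ^ 2 + k Wh Wh := by
    rw [hnormh, Real.sq_sqrt (add_nonneg (sq_nonneg _) (hk_pos Wh))]
  constructor
  · rw [hsq, hAh]
    linarith [hGarding (Proj Wh), mul_le_of_le_one_left (hk_pos Wh) hc₁1]
  · have hCS : k Wh Yh ^ 2 ≤ k Wh Wh * k Yh Yh :=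
      LinearMap.BilinForm.apply_sq_le_of_symm k hk_pos ⟨hk_symm⟩ Wh Yh
    calc |Ah Wh Yh| ≤ |A (Proj Wh) (Proj Yh)| + |k Wh Yh| := by
          rw [hAh]; exact abs_add_le _ _
      _ ≤ CA * ‖Proj Wh‖ * ‖Proj Yh‖ + CA * |k Wh Yh| :=
          add_le_add (hcont _ _) (le_mul_of_one_le_left (abs_nonneg _) hCA)
      _ = CA * (‖Proj Wh‖ * ‖Proj Yh‖ + |k Wh Yh|) := by ring
      _ ≤ CA * (normh Wh * normh Yh) := by
          rw [hnormh, hnormh]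
          exact mul_le_mul_of_nonneg_left
            (mul_add_abs_le_sqrt_mul_sqrt (hk_pos _) (hk_pos _) hCS) (by linarith)
      _ = CA * normh Wh * normh Yh := by ring
end

section
/- (Optimal error estimate.) Assume the hypotheses of the conditional quasi-optimality statement hold: |𝒜[X, Y]| ≤ C_𝒜 ‖X‖ ‖Y‖ with C_𝒜 ≥ 0; c₁ ‖Y‖² − c₂ |Y|₀² ≤ 𝒜[Y, Y] for all Y ∈ V with 0 < c₁ ≤ 1, c₂ > 0; W ∈ V and W_h ∈ V_h satisfy 𝒜[W − Π W_h, Π Y_h] = k(W_h, Y_h) for all Y_h ∈ V_h; |W − Π W_h|₀ ≤ C₈ h E_h[W, W_h] with C₈ > 0; and 0 < h ≤ h₀ := (c₁ / (4 c₂ C₈²))^{1/2}. Assume additionally that there exist constants C₇, C₃′ ≥ 0, real numbers M ≥ 0 and g ≥ 0, and an element V_h* ∈ V_h such that E_h[W, V_h*] ≤ C₇ h M and M ≤ C₃′ g. Then |W − Π W_h|₀ + h · E_h[W, W_h] ≤ (1 + C₈) C₉ C₇ C₃′ h² g, where C₉ := √2 · max{1, C_𝒜} / c₁. -/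
/-- The sum of two products is bounded by the larger coefficient times the product of the
Euclidean norms, when the second product is only known through its square. -/
lemma mul_mul_add_le_max_mul_sqrt_mul_sqrt {C a b p q r : ℝ} (ha : 0 ≤ a) (hb : 0 ≤ b)
    (hp : 0 ≤ p) (hq : 0 ≤ q) (hr : r ^ 2 ≤ p * q) :
    C * a * b + r ≤ max 1 C * (√(a ^ 2 + p) * √(b ^ 2 + q)) := by
  have hab : 0 ≤ a * b := mul_nonneg ha hb
  have hr' : |r| ≤ √(p * q) := Real.abs_le_sqrt hr
  have hpq : √(p * q) ^ 2 = p * q := Real.sq_sqrt (mul_nonneg hp hq)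
  have hp2 : √p ^ 2 = p := Real.sq_sqrt hp
  have hq2 : √q ^ 2 = q := Real.sq_sqrt hq
  have hmul : √(p * q) = √p * √q := Real.sqrt_mul hp q
  have hcs : a * b + √(p * q) ≤ √(a ^ 2 + p) * √(b ^ 2 + q) := by
    rw [← Real.sqrt_mul (by positivity)]
    apply Real.le_sqrt_of_sq_le
    rw [hmul] at hpq ⊢
    nlinarith [sq_nonneg (a * √q - b * √p)]
  calc C * a * b + r = C * (a * b) + r := by ring
    _ ≤ max 1 C * (a * b) + max 1 C * √(p * q) := by
      refine add_le_add (mul_le_mul_of_nonneg_right (le_max_right _ _) hab) ?_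
      exact ((le_abs_self r).trans hr').trans
        (le_mul_of_one_le_left (Real.sqrt_nonneg _) (le_max_left _ _))
    _ = max 1 C * (a * b + √(p * q)) := by ring
    _ ≤ _ := by gcongr

lemma four_thirds_le_sqrt_two : (4 / 3 : ℝ) ≤ √2 :=
  Real.le_sqrt_of_sq_le (by norm_num)

/-- Absorption: a quadratic lower bound whose lower-order term is controlled by `E` yields a
linear bound on `E`. -/
lemma le_sqrt_two_mul_of_absorb {c₁ c₂ C₈ h E F K n s κ : ℝ} (hc₁ : 0 < c₁) (hc₁1 : c₁ ≤ 1)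
    (hc₂ : 0 < c₂) (hC₈ : 0 < C₈) (hh : 0 < h) (hE : 0 ≤ E) (hF : 0 ≤ F) (hK : 0 ≤ K)
    (hs0 : 0 ≤ s) (hκ : 0 ≤ κ) (hE2 : E ^ 2 = n ^ 2 + κ) (hs : s ≤ C₈ * h * E)
    (hsmall : h ≤ √(c₁ / (4 * c₂ * C₈ ^ 2)))
    (hbound : c₁ * n ^ 2 - c₂ * s ^ 2 + κ ≤ K * (E * F)) :
    E ≤ √2 * K / c₁ * F := by
  have hh2 : h ^ 2 ≤ c₁ / (4 * c₂ * C₈ ^ 2) :=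
    (Real.le_sqrt hh.le (by positivity)).1 hsmall
  rw [le_div_iff₀ (by positivity)] at hh2
  have hs2 : s ^ 2 ≤ (C₈ * h * E) ^ 2 := by gcongr
  have habsorb : c₂ * s ^ 2 ≤ c₁ / 4 * E ^ 2 := by
    calc c₂ * s ^ 2 ≤ c₂ * (C₈ * h * E) ^ 2 := by gcongr
      _ = h ^ 2 * (4 * c₂ * C₈ ^ 2) / 4 * E ^ 2 := by ring
      _ ≤ c₁ / 4 * E ^ 2 := by gcongr
  have hquad : E * (c₁ * E) ≤ E * (4 / 3 * K * F) := by
    nlinarith [mul_le_mul_of_nonneg_right hc₁1 hκ]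
  have hKF : 4 / 3 * (K * F) ≤ √2 * (K * F) :=
    mul_le_mul_of_nonneg_right four_thirds_le_sqrt_two (mul_nonneg hK hF)
  have hlin : c₁ * E ≤ √2 * K * F := by
    rcases hE.eq_or_lt with hE0 | hEpos
    · rw [← hE0, mul_zero]
      positivity
    · linarith [le_of_mul_le_mul_left hquad hEpos]
  rw [div_mul_eq_mul_div, le_div_iff₀ hc₁]
  linarith


/-- **Optimal error estimate** (abstract form of the paper's Theorem "optimal error
estimates"). Under the hypotheses of conditional quasi-optimality, together with an
interpolation error estimate `E_h[W, V_h*] ≤ C₇ h M` and a regularity estimate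
`M ≤ C₃′ g`, the Galerkin solution satisfies
`|W − Π W_h|₀ + h E_h[W, W_h] ≤ (1 + C₈) C₉ C₇ C₃′ h² g` with
`C₉ = √2 · max{1, C_𝒜} / c₁`. -/
theorem optimal_error_estimate {V Vh : Type*}
    [NormedAddCommGroup V] [NormedSpace ℝ V]
    [AddCommGroup Vh] [Module ℝ Vh]
    (A : V →ₗ[ℝ] V →ₗ[ℝ] ℝ)
    (ip0 : V →ₗ[ℝ] V →ₗ[ℝ] ℝ)
    (hip0_symm : ∀ x y : V, ip0 x y = ip0 y x) (hip0_pos : ∀ x : V, 0 ≤ ip0 x x)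
    (Proj : Vh →ₗ[ℝ] V)
    (k : Vh →ₗ[ℝ] Vh →ₗ[ℝ] ℝ)
    (hk_symm : ∀ x y : Vh, k x y = k y x) (hk_pos : ∀ x : Vh, 0 ≤ k x x)
    (sem0 : V → ℝ) (hsem0 : ∀ v : V, sem0 v = Real.sqrt (ip0 v v))
    (Eh : V → Vh → ℝ)
    (hEh : ∀ (v : V) (vh : Vh), Eh v vh = Real.sqrt (‖v - Proj vh‖ ^ 2 + k vh vh))
    (CA : ℝ) (hCA : 0 ≤ CA)
    (hcont : ∀ x y : V, |A x y| ≤ CA * ‖x‖ * ‖y‖)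
    (c₁ c₂ : ℝ) (hc₁0 : 0 < c₁) (hc₁1 : c₁ ≤ 1) (hc₂ : 0 < c₂)
    (hGarding : ∀ Y : V, c₁ * ‖Y‖ ^ 2 - c₂ * (sem0 Y) ^ 2 ≤ A Y Y)
    (W : V) (Wh : Vh)
    (hQO : ∀ Yh : Vh, A (W - Proj Wh) (Proj Yh) = k Wh Yh)
    (C₈ : ℝ) (hC₈ : 0 < C₈) (h : ℝ) (hh : 0 < h)
    (hL2 : sem0 (W - Proj Wh) ≤ C₈ * h * Eh W Wh)
    (hsmall : h ≤ Real.sqrt (c₁ / (4 * c₂ * C₈ ^ 2)))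
    (C₇ C₃' : ℝ) (hC₇ : 0 ≤ C₇) (hC₃' : 0 ≤ C₃')
    (M g : ℝ) (hM : 0 ≤ M) (hg : 0 ≤ g)
    (Vhstar : Vh)
    (hinterp : Eh W Vhstar ≤ C₇ * h * M)
    (hreg : M ≤ C₃' * g) :
    sem0 (W - Proj Wh) + h * Eh W Wh ≤
      (1 + C₈) * (Real.sqrt 2 * max 1 CA / c₁) * C₇ * C₃' * h ^ 2 * g := by
  have hEnn : ∀ v vh, 0 ≤ Eh v vh := fun v vh => hEh v vh ▸ Real.sqrt_nonneg _
  have hE2 : Eh W Wh ^ 2 = ‖W - Proj Wh‖ ^ 2 + k Wh Wh := by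
    rw [hEh, Real.sq_sqrt (add_nonneg (sq_nonneg _) (hk_pos _))]
  have hkcs : k Wh Vhstar ^ 2 ≤ k Wh Wh * k Vhstar Vhstar :=
    LinearMap.BilinForm.apply_sq_le_of_symm k hk_pos ⟨hk_symm⟩ Wh Vhstar
  have hsplit : A (W - Proj Wh) (W - Proj Wh) + k Wh Wh =
      A (W - Proj Wh) (W - Proj Vhstar) + k Wh Vhstar := by
    rw [← hQO Wh, ← hQO Vhstar, ← map_add, ← map_add, sub_add_cancel, sub_add_cancel]
  have hA : A (W - Proj Wh) (W - Proj Vhstar) ≤ CA * ‖W - Proj Wh‖ * ‖W - Proj Vhstar‖ :=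
    (le_abs_self _).trans (hcont _ _)
  have hupper := mul_mul_add_le_max_mul_sqrt_mul_sqrt (C := CA) (norm_nonneg (W - Proj Wh))
    (norm_nonneg (W - Proj Vhstar)) (hk_pos Wh) (hk_pos Vhstar) hkcs
  rw [← hEh, ← hEh] at hupper
  have hK : 0 ≤ max 1 CA := zero_le_one.trans (le_max_left _ _)
  have hquasi : Eh W Wh ≤ √2 * max 1 CA / c₁ * Eh W Vhstar :=
    le_sqrt_two_mul_of_absorb hc₁0 hc₁1 hc₂ hC₈ hh (hEnn _ _) (hEnn _ _) hK
      (hsem0 _ ▸ Real.sqrt_nonneg _) (hk_pos Wh) hE2 hL2 hsmall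
      (by linarith [hGarding (W - Proj Wh)])
  calc sem0 (W - Proj Wh) + h * Eh W Wh ≤ (1 + C₈) * h * Eh W Wh := by linarith
    _ ≤ (1 + C₈) * h * (√2 * max 1 CA / c₁ * (C₇ * h * (C₃' * g))) := by
      gcongr
      refine hquasi.trans ?_
      gcongr
      exact hinterp.trans (by gcongr)
    _ = _ := by ring
end
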